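/- Let (X,d) be a metric space. Suppose there exist t ∈ (1,2) and C > 0 such that for every s > 0 and every measure ν = Σ_{i=1}^N c_i δ_{x_i} that is a finite sum of positive multiples of Dirac deltas at points of X, the bound ‖A_{t,s,ν} f‖_{L¹(ν)} ≤ C‖f‖_{L¹(ν)} holds for every f ∈ L¹(ν). Then (X,d) is geometrically doubling, with geometrically doubling constant at most C^⌈1/log₂ t⌉, where ⌈·⌉ denotes the ceiling function. -/

import Mathlib

open MeasureTheory Metric Bornology ENNReal NNReal

/-- The modified averaging operator
`A_{t,s,ν} f (x) = (1/ν(B(x,s))) ∫_{B(x,ts)} f dν` (real-valued). -/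
noncomputable def avgOp {X : Type*} [MetricSpace X] [MeasurableSpace X]
    (ν : Measure X) (t s : ℝ) (f : X → ℝ) (x : X) : ℝ :=
  (∫ y in Metric.closedBall x (t * s), f y ∂ν) /
    (ν (Metric.closedBall x s)).toReal

/-- The weight `1` at `x` and the weight `n` at each of the points `z i`. -/
theorem sum_cons_smul_dirac {X : Type*} [MeasurableSpace X] {M : ℕ} (n : ℝ≥0) (x : X)
    (z : Fin M → X) :
    ∑ i : Fin (M + 1), (((Fin.cons 1 fun _ ↦ n : Fin (M + 1) → ℝ≥0) i : ℝ≥0) : ℝ≥0∞) •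
        Measure.dirac ((Fin.cons x z : Fin (M + 1) → X) i) =
      Measure.dirac x + ∑ i, (n : ℝ≥0∞) • Measure.dirac (z i) := by
  simp [Fin.sum_univ_succ]

/-- If `x` has positive finite mass, the `L¹` bound for the indicator of `{x}` controls the number of
`s`-separated points in the ball of radius `t * s` around `x`, up to the factor `n / (n + 1)`. -/
theorem card_mul_le_of_avgOp_bound {X : Type*} [MetricSpace X] [MeasurableSpace X] [BorelSpace X]
    {t s C : ℝ} (hC : 0 < C) (hs : 0 < s) {M : ℕ} {n : ℝ≥0} (hn : 0 < n) {x : X} {z : Fin M → X}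
    (hz : ∀ i, z i ∈ closedBall x (t * s)) (hsep : ∀ i j, i ≠ j → s < dist (z i) (z j))
    {ν : Measure X} (hν : ν = Measure.dirac x + ∑ i, (n : ℝ≥0∞) • Measure.dirac (z i))
    (h : ∀ f : X → ℝ, Integrable f ν →
      eLpNorm (avgOp ν t s f) 1 ν ≤ ENNReal.ofReal C * eLpNorm f 1 ν) :
    (M : ℝ) * n ≤ C * (n + 1) := by
  have hfin : IsFiniteMeasure ν := by
    refine ⟨?_⟩
    simp [hν, ENNReal.mul_lt_top_iff]
  have hx : 0 < ν.real {x} := by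
    refine ENNReal.toReal_pos ?_ (measure_ne_top _ _)
    simp [hν]
  have hball (i : Fin M) : n ≤ ν.real (closedBall (z i) s) ∧
      ν.real (closedBall (z i) s) ≤ n + 1 := by
    have hsum : ∑ j, (n : ℝ≥0∞) * (Measure.dirac (z j)) (closedBall (z i) s) = n := by
      rw [Finset.sum_eq_single i]
      · simp [hs.le]
      · intro j _ hj
        simp [hsep j i hj]
      · simp
    have hval : ν (closedBall (z i) s) = (Measure.dirac x) (closedBall (z i) s) + n := by
      rw [← hsum]
      simp only [hν, Measure.add_apply, Measure.finsetSum_apply, Measure.smul_apply, smul_eq_mul]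
    have hle : (Measure.dirac x) (closedBall (z i) s) ≤ 1 := prob_le_one
    rw [Measure.real, hval, ENNReal.toReal_add (measure_ne_top _ _) ENNReal.coe_ne_top]
    have h1 := ENNReal.toReal_mono ENNReal.one_ne_top hle
    have h0 : 0 ≤ ((Measure.dirac x) (closedBall (z i) s)).toReal := ENNReal.toReal_nonneg
    simp only [ENNReal.toReal_one, ENNReal.coe_toReal] at *
    constructor <;> linarith
  set f : X → ℝ := Set.indicator {x} 1 with hf
  have hn' : (0 : ℝ) < n := hn
  have havg (i : Fin M) :
      ENNReal.ofReal (ν.real {x} / (n + 1)) ≤ ‖avgOp ν t s f (z i)‖ₑ := by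
    have hint : ∫ y in closedBall (z i) (t * s), f y ∂ν = ν.real {x} := by
      rw [hf, integral_indicator_one (measurableSet_singleton x),
        measureReal_restrict_apply (measurableSet_singleton x), Set.inter_eq_left.2]
      simpa [dist_comm] using hz i
    rw [avgOp, hint, ← Measure.real, Real.enorm_of_nonneg (by positivity)]
    have := hball i
    exact ENNReal.ofReal_le_ofReal (div_le_div_of_nonneg_left hx.le (by linarith) this.2)
  have hlower : ENNReal.ofReal (M * (n * (ν.real {x} / (n + 1)))) ≤
      eLpNorm (avgOp ν t s f) 1 ν := by
    rw [eLpNorm_one_eq_lintegral_enorm]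
    calc ENNReal.ofReal (M * (n * (ν.real {x} / (n + 1))))
        = ∑ _i : Fin M, (n : ℝ≥0∞) * ENNReal.ofReal (ν.real {x} / (n + 1)) := by
          rw [ENNReal.ofReal_mul (by positivity), ENNReal.ofReal_mul (by positivity)]
          simp
      _ ≤ ∑ i : Fin M, (n : ℝ≥0∞) * ‖avgOp ν t s f (z i)‖ₑ := by
          gcongr with i
          exact havg i
      _ = ∫⁻ y, ‖avgOp ν t s f y‖ₑ ∂(∑ i, (n : ℝ≥0∞) • Measure.dirac (z i)) := by
          simp only [lintegral_finsetSum_measure, lintegral_smul_measure, lintegral_dirac,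
            smul_eq_mul]
      _ ≤ ∫⁻ y, ‖avgOp ν t s f y‖ₑ ∂ν :=
          lintegral_mono' (by rw [hν]; exact Measure.le_add_left le_rfl) le_rfl
  have hnorm : eLpNorm f 1 ν = ENNReal.ofReal (ν.real {x}) := by
    rw [eLpNorm_one_eq_lintegral_enorm, hf]
    simp [enorm_indicator_eq_indicator_enorm, Measure.real]
  have hfint : Integrable f ν :=
    (integrable_const (1 : ℝ)).indicator (measurableSet_singleton x)
  have hmain := hlower.trans (h f hfint)
  rw [hnorm, ← ENNReal.ofReal_mul hC.le, ENNReal.ofReal_le_ofReal_iff (by positivity)] at hmain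
  have hrw : (M : ℝ) * (n * (ν.real {x} / (n + 1))) = M * n / (n + 1) * ν.real {x} := by ring
  rw [hrw] at hmain
  exact (div_le_iff₀ (by positivity)).1 (le_of_mul_le_mul_right hmain hx)

theorem le_of_forall_nat_mul_le {a b : ℝ}
    (h : ∀ n : ℕ, 0 < n → a * n ≤ b * (n + 1)) : a ≤ b := by
  by_contra! hab
  obtain ⟨n, hn⟩ := exists_nat_gt (|b| / (a - b))
  have hn0 : 0 < n := by
    have : (0 : ℝ) < n := lt_of_le_of_lt (div_nonneg (abs_nonneg b) (by linarith)) hn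
    exact_mod_cast this
  rw [div_lt_iff₀ (by linarith)] at hn
  nlinarith [h n hn0, le_abs_self b]

/-- A set whose `s`-separated finite subsets have at most `C` elements is covered by at most `C`
closed balls of radius `s`. -/
theorem exists_finset_cover_of_separated_card_le {X : Type*} [MetricSpace X] {s C : ℝ} (hs : 0 ≤ s)
    {B : Set X} (hB : ∀ T : Finset X, (T : Set X) ⊆ B →
      (T : Set X).Pairwise (fun y z ↦ s < dist y z) → (T.card : ℝ) ≤ C) :
    ∃ T : Finset X, (T.card : ℝ) ≤ C ∧ B ⊆ ⋃ y ∈ T, closedBall y s := by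
  classical
  by_contra! hcon
  have hlarge (M : ℕ) : ∃ T : Finset X, T.card = M ∧ (T : Set X) ⊆ B ∧
      (T : Set X).Pairwise (fun y z ↦ s < dist y z) := by
    induction M with
    | zero => exact ⟨∅, by simp⟩
    | succ M ih =>
      obtain ⟨T, hcard, hTB, hsep⟩ := ih
      obtain ⟨p, hpB, hp⟩ := Set.not_subset.1 (hcon T (hB T hTB hsep))
      simp only [Set.mem_iUnion, mem_closedBall, not_exists, not_le] at hp
      have hpT : p ∉ T := fun hpT ↦ absurd (hp p hpT) (by simpa using hs)
      refine ⟨insert p T, by rw [Finset.card_insert_of_notMem hpT, hcard], ?_, ?_⟩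
      · rw [Finset.coe_insert]
        exact Set.insert_subset hpB hTB
      · rw [Finset.coe_insert]
        refine hsep.insert fun y hy _ ↦ ⟨hp y hy, ?_⟩
        rw [dist_comm]
        exact hp y hy
  obtain ⟨M, hM⟩ := exists_nat_gt C
  obtain ⟨T, rfl, hTB, hsep⟩ := hlarge M
  exact absurd (hB T hTB hsep) (not_le.2 hM)

/-- If every ball of radius `t * s` is covered by at most `C` balls of radius `s`, then every ball of
radius `r` is covered by at most `C ^ k` balls of radius `r / t ^ k`. -/
theorem exists_finset_cover_pow {X : Type*} [MetricSpace X] {t C : ℝ} (ht : 0 < t) (hC : 0 < C)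
    (h : ∀ (x : X) (s : ℝ), 0 < s → ∃ T : Finset X, (T.card : ℝ) ≤ C ∧
      closedBall x (t * s) ⊆ ⋃ y ∈ T, closedBall y s)
    (k : ℕ) (x : X) {r : ℝ} (hr : 0 < r) :
    ∃ T : Finset X, (T.card : ℝ) ≤ C ^ k ∧ closedBall x r ⊆ ⋃ y ∈ T, closedBall y (r / t ^ k) := by
  classical
  induction k with
  | zero => exact ⟨{x}, by simp⟩
  | succ k ih =>
    obtain ⟨T, hcard, hT⟩ := ih
    choose S hScard hS using fun y : X ↦ h y (r / t ^ (k + 1)) (by positivity)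
    have hrad : t * (r / t ^ (k + 1)) = r / t ^ k := by
      field_simp
      rw [pow_succ']
    refine ⟨T.biUnion S, ?_, fun p hp ↦ ?_⟩
    · calc ((T.biUnion S).card : ℝ) ≤ ∑ y ∈ T, ((S y).card : ℝ) := by
            exact_mod_cast Finset.card_biUnion_le
        _ ≤ T.card * C := by
            rw [← nsmul_eq_mul]
            exact Finset.sum_le_card_nsmul T _ C fun y _ ↦ hScard y
        _ ≤ C ^ k * C := by gcongr
        _ = C ^ (k + 1) := (pow_succ C k).symm
    · obtain ⟨y, hy, hpy⟩ := Set.mem_iUnion₂.1 (hT hp)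
      obtain ⟨q, hq, hpq⟩ := Set.mem_iUnion₂.1 (hS y (hrad ▸ hpy))
      exact Set.mem_iUnion₂.2 ⟨q, Finset.mem_biUnion.2 ⟨y, hy, hq⟩, hpq⟩

theorem two_le_pow_ceil_one_div_logb {t : ℝ} (ht : 1 < t) :
    2 ≤ t ^ ⌈1 / Real.logb 2 t⌉₊ := by
  have hlog : 0 < Real.logb 2 t := Real.logb_pos one_lt_two ht
  have hk : 1 ≤ (⌈1 / Real.logb 2 t⌉₊ : ℝ) * Real.logb 2 t :=
    (div_le_iff₀ hlog).1 (Nat.le_ceil _)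
  rw [← Real.logb_pow, Real.le_logb_iff_rpow_le one_lt_two (by positivity), Real.rpow_one] at hk
  exact hk

theorem stmt10 {X : Type*} [MetricSpace X] [MeasurableSpace X] [BorelSpace X]
    (t C : ℝ) (ht : 1 < t) (ht' : t < 2) (hC : 0 < C)
    (h : ∀ s : ℝ, 0 < s → ∀ (N : ℕ) (c : Fin N → ℝ≥0) (x : Fin N → X),
      (∀ i, 0 < c i) →
      ∀ ν : Measure X, ν = ∑ i : Fin N, (c i : ℝ≥0∞) • Measure.dirac (x i) →
        ∀ f : X → ℝ, Integrable f ν →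
          eLpNorm (avgOp ν t s f) 1 ν ≤ ENNReal.ofReal C * eLpNorm f 1 ν) :
    ∀ (x : X) (r : ℝ), 0 < r → ∃ s : Finset X,
      (s.card : ℝ) ≤ C ^ ⌈1 / Real.logb 2 t⌉₊ ∧
      Metric.closedBall x r ⊆ ⋃ y ∈ s, Metric.closedBall y (r / 2) := by
  have hcover (x : X) (s : ℝ) (hs : 0 < s) : ∃ T : Finset X, (T.card : ℝ) ≤ C ∧
      closedBall x (t * s) ⊆ ⋃ y ∈ T, closedBall y s := by
    refine exists_finset_cover_of_separated_card_le hs.le fun T hTB hsep ↦ ?_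
    refine le_of_forall_nat_mul_le fun n hn ↦ ?_
    have hn' : (0 : ℝ≥0) < n := by exact_mod_cast hn
    let z : Fin T.card → X := fun i ↦ T.equivFin.symm i
    have hz (i) : z i ∈ closedBall x (t * s) := hTB (T.equivFin.symm i).2
    have hzsep (i j) (hij : i ≠ j) : s < dist (z i) (z j) :=
      hsep (T.equivFin.symm i).2 (T.equivFin.symm j).2 fun heq ↦
        hij (T.equivFin.symm.injective (Subtype.ext heq))
    have hbound := h s hs (T.card + 1) (Fin.cons 1 fun _ ↦ (n : ℝ≥0)) (Fin.cons x z)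
      (Fin.cases (by simp) (fun _ ↦ by simpa using hn)) _ (sum_cons_smul_dirac _ x z).symm
    simpa using card_mul_le_of_avgOp_bound hC hs hn' hz hzsep rfl hbound
  intro x r hr
  obtain ⟨T, hcard, hT⟩ :=
    exists_finset_cover_pow (by linarith) hC hcover ⌈1 / Real.logb 2 t⌉₊ x hr
  refine ⟨T, hcard, hT.trans (Set.iUnion₂_mono fun y _ ↦ closedBall_subset_closedBall ?_)⟩
  exact div_le_div_of_nonneg_left hr.le two_pos (two_le_pow_ceil_one_div_logb ht)
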